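/- Let G be a finite simple graph on vertex set {t_1,…,t_s} without isolated vertices and let I = I(G) ⊆ S = K[t_1,…,t_s] be its edge ideal. Then G belongs to the class W_2 (i.e., G is well-covered, G ∖ v is well-covered for every vertex v, and G has no isolated vertices) if and only if the v-number v(I) equals the Krull dimension of S/I. -/

import Mathlib

open MvPolynomial

/-- A set of vertices is stable (independent) in `G`. -/
def IsStableSet' {V : Type*} (G : SimpleGraph V) (A : Set V) : Prop :=
  ∀ a ∈ A, ∀ b ∈ A, ¬ G.Adj a b

/-- `G` is well-covered: all maximal stable sets have the same cardinality. -/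
def WellCovered {V : Type*} (G : SimpleGraph V) : Prop :=
  ∀ A B : Set V,
    (IsStableSet' G A ∧ ∀ A' : Set V, IsStableSet' G A' → A ⊆ A' → A = A') →
    (IsStableSet' G B ∧ ∀ B' : Set V, IsStableSet' G B' → B ⊆ B' → B = B') →
    A.ncard = B.ncard

section Combinatorics

variable {V : Type*} {G : SimpleGraph V} {A B : Set V}

/-- A maximal stable set of vertices. -/
abbrev IsMaximalStableSet (G : SimpleGraph V) (A : Set V) : Prop :=
  IsStableSet' G A ∧ ∀ A' : Set V, IsStableSet' G A' → A ⊆ A' → A = A'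

/-- The vertices adjacent to some member of `A`. -/
def neighborsOf (G : SimpleGraph V) (A : Set V) : Set V :=
  {v | ∃ a ∈ A, G.Adj a v}

/-- A stable set whose neighbors form a vertex cover. -/
def IsCoveringStableSet (G : SimpleGraph V) (A : Set V) : Prop :=
  IsStableSet' G A ∧ IsStableSet' G (neighborsOf G A)ᶜ

lemma IsStableSet'.mono (hB : IsStableSet' G B) (h : A ⊆ B) : IsStableSet' G A :=
  fun a ha b hb => hB a (h ha) b (h hb)

lemma IsStableSet'.subset_compl_neighborsOf (hA : IsStableSet' G A) :
    A ⊆ (neighborsOf G A)ᶜ := by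
  rintro a ha ⟨b, hb, hba⟩
  exact hA b hb a ha hba

lemma IsStableSet'.insert (hA : IsStableSet' G A) {v : V} (hv : v ∉ neighborsOf G A) :
    IsStableSet' G (insert v A) := by
  rintro a (rfl | ha) b (rfl | hb) hab
  · exact G.irrefl hab
  · exact hv ⟨b, hb, hab.symm⟩
  · exact hv ⟨a, ha, hab⟩
  · exact hA a ha b hb hab

lemma isMaximalStableSet_iff :
    IsMaximalStableSet G A ↔ IsStableSet' G A ∧ ∀ v, v ∉ A → v ∈ neighborsOf G A := by
  refine ⟨fun h => ⟨h.1, fun v hv => ?_⟩, fun h => ⟨h.1, fun B hB hAB => ?_⟩⟩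
  · by_contra hn
    have heq := h.2 _ (h.1.insert hn) (Set.subset_insert v A)
    exact hv (heq ▸ Set.mem_insert v A)
  · refine hAB.antisymm fun v hv => ?_
    by_contra hvA
    obtain ⟨a, ha, hav⟩ := h.2 v hvA
    exact hB a (hAB ha) v hv hav

lemma IsMaximalStableSet.isCoveringStableSet (hA : IsMaximalStableSet G A) :
    IsCoveringStableSet G A :=
  ⟨hA.1, hA.1.mono fun v hv => by_contra fun hvA => hv ((isMaximalStableSet_iff.1 hA).2 v hvA)⟩

lemma IsCoveringStableSet.isMaximalStableSet_compl (hA : IsCoveringStableSet G A) :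
    IsMaximalStableSet G (neighborsOf G A)ᶜ := by
  refine isMaximalStableSet_iff.2 ⟨hA.2, fun v hv => ?_⟩
  obtain ⟨a, ha, hav⟩ := not_not.1 hv
  exact ⟨a, hA.1.subset_compl_neighborsOf ha, hav⟩

lemma IsStableSet'.exists_isMaximalStableSet_superset [Finite V] (hA : IsStableSet' G A) :
    ∃ B, A ⊆ B ∧ IsMaximalStableSet G B := by
  obtain ⟨B, hAB, hB⟩ := Finite.exists_le_maximal (p := IsStableSet' G) hA
  exact ⟨B, hAB, hB.1, fun C hC hBC => hBC.antisymm (hB.2 hC hBC)⟩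

lemma IsStableSet'.image_val {v : V} {A : Set {u : V | u ≠ v}}
    (hA : IsStableSet' (G.induce {u : V | u ≠ v}) A) : IsStableSet' G (Subtype.val '' A) := by
  rintro _ ⟨a, ha, rfl⟩ _ ⟨b, hb, rfl⟩ hab
  exact hA a ha b hb hab

lemma IsStableSet'.preimage_val (hA : IsStableSet' G A) (v : V) :
    IsStableSet' (G.induce {u : V | u ≠ v}) (Subtype.val ⁻¹' A) :=
  fun a ha b hb hab => hA a ha b hb hab

lemma ncard_preimage_val (A : Set V) (v : V) :
    (Subtype.val ⁻¹' A : Set {u : V | u ≠ v}).ncard = (A \ {v}).ncard := by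
  rw [← Set.ncard_image_of_injective _ Subtype.val_injective, Subtype.image_preimage_coe]
  congr 1
  ext u
  simp [and_comm]

lemma isMaximalStableSet_preimage_val {v : V} (hA : IsStableSet' G A)
    (h : ∀ u, u ∉ A → u ≠ v → u ∈ neighborsOf G (A \ {v})) :
    IsMaximalStableSet (G.induce {u : V | u ≠ v}) (Subtype.val ⁻¹' A) := by
  refine isMaximalStableSet_iff.2 ⟨hA.preimage_val v, fun u hu => ?_⟩
  obtain ⟨a, ha, hau⟩ := h u hu u.2
  exact ⟨⟨a, ha.2⟩, ha.1, hau⟩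

lemma wellCovered_of_le_ncard_covering [Finite V] {n : ℕ}
    (hmax : ∀ A, IsStableSet' G A → A.ncard ≤ n)
    (h : ∀ A, IsCoveringStableSet G A → n ≤ A.ncard) : WellCovered G := fun A B hA hB =>
  ((hmax A hA.1).antisymm (h A (IsMaximalStableSet.isCoveringStableSet hA))).trans
    ((hmax B hB.1).antisymm (h B (IsMaximalStableSet.isCoveringStableSet hB))).symm

lemma wellCovered_induce_of_le_ncard_covering [Finite V] {n : ℕ}
    (hmax : ∀ A, IsStableSet' G A → A.ncard ≤ n)
    (h : ∀ A, IsCoveringStableSet G A → n ≤ A.ncard) (v : V) :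
    WellCovered (G.induce {u : V | u ≠ v}) := by
  have key : ∀ A, IsMaximalStableSet (G.induce {u : V | u ≠ v}) A → A.ncard = n := by
    intro A hA
    rw [← Set.ncard_image_of_injective A Subtype.val_injective]
    refine (hmax _ hA.1.image_val).antisymm (h _ ?_)
    have hdom : ∀ u, u ∉ Subtype.val '' A → u ≠ v → u ∈ neighborsOf G (Subtype.val '' A) := by
      intro u hu huv
      obtain ⟨a, ha, hau⟩ := (isMaximalStableSet_iff.1 hA).2 ⟨u, huv⟩
        fun hmem => hu ⟨_, hmem, rfl⟩
      exact ⟨a, ⟨a, ha, rfl⟩, hau⟩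
    refine ⟨hA.1.image_val, ?_⟩
    by_cases hv : v ∈ neighborsOf G (Subtype.val '' A)
    · refine hA.1.image_val.mono fun u hu => by_contra fun huA => hu ?_
      by_cases huv : u = v
      · exact huv ▸ hv
      · exact hdom u huA huv
    · refine (hA.1.image_val.insert hv).mono fun u hu => ?_
      by_contra hins
      rw [Set.mem_insert_iff, not_or] at hins
      exact hu (hdom u hins.2 hins.1)
  exact fun A B hA hB => (key A hA).trans (key B hB).symm

lemma le_ncard_of_covering [Finite V] (hiso : ∀ v, ∃ u, G.Adj v u) {n : ℕ}
    (hn : ∃ A, IsStableSet' G A ∧ A.ncard = n)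
    (hmax : ∀ A, IsStableSet' G A → A.ncard ≤ n) (hG : WellCovered G)
    (hGv : ∀ v : V, WellCovered (G.induce {u : V | u ≠ v})) (hA : IsCoveringStableSet G A) :
    n ≤ A.ncard := by
  obtain ⟨M, hM, rfl⟩ := hn
  have hMmax : IsMaximalStableSet G M :=
    ⟨hM, fun B hB hMB => Set.eq_of_subset_of_ncard_le hMB (hmax B hB)⟩
  have hB := hA.isMaximalStableSet_compl
  rw [hG _ _ hMmax hB]
  suffices h : (neighborsOf G A)ᶜ ⊆ A from Set.ncard_le_ncard h
  intro v hv
  by_contra hvA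
  obtain ⟨u, huv⟩ := hiso v
  obtain ⟨C, huC, hC⟩ := IsStableSet'.exists_isMaximalStableSet_superset
    (G := G) (A := {u}) (by rintro _ rfl _ rfl; exact G.irrefl)
  have hvC : v ∉ C := fun hvC => hC.1 v hvC u (huC rfl) huv
  have h1 : IsMaximalStableSet (G.induce {u : V | u ≠ v}) (Subtype.val ⁻¹' C) := by
    refine isMaximalStableSet_preimage_val hC.1 fun w hw _ => ?_
    rw [Set.sdiff_singleton_eq_self hvC]
    exact (isMaximalStableSet_iff.1 hC).2 w hw
  have h2 : IsMaximalStableSet (G.induce {u : V | u ≠ v})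
      (Subtype.val ⁻¹' (neighborsOf G A)ᶜ) := by
    refine isMaximalStableSet_preimage_val hB.1 fun w hw _ => ?_
    obtain ⟨a, ha, haw⟩ := not_not.1 hw
    exact ⟨a, ⟨hA.1.subset_compl_neighborsOf ha, fun hav => hvA (hav ▸ ha)⟩, haw⟩
  have h3 := hGv v _ _ h1 h2
  rw [ncard_preimage_val, ncard_preimage_val, Set.sdiff_singleton_eq_self hvC,
    hG _ _ hC hB] at h3
  exact (Set.ncard_sdiff_singleton_lt_of_mem hv).ne' h3

end Combinatorics

section EdgeIdeal

variable {V : Type*} {G : SimpleGraph V}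

/-- The edge ideal of a graph. -/
noncomputable def edgeIdeal (K : Type*) [Field K] (G : SimpleGraph V) : Ideal (MvPolynomial V K) :=
  Ideal.span {f | ∃ i j : V, G.Adj i j ∧ f = X i * X j}

variable {K : Type*} [Field K]

lemma X_mul_X_mem_edgeIdeal {i j : V} (h : G.Adj i j) :
    (X i * X j : MvPolynomial V K) ∈ edgeIdeal K G :=
  Ideal.subset_span ⟨i, j, h, rfl⟩

lemma edgeIdeal_le_iff {J : Ideal (MvPolynomial V K)} :
    edgeIdeal K G ≤ J ↔ ∀ i j, G.Adj i j → X i * X j ∈ J := by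
  rw [edgeIdeal, Ideal.span_le]
  exact ⟨fun h i j hij => h ⟨i, j, hij, rfl⟩, by rintro h _ ⟨i, j, hij, rfl⟩; exact h i j hij⟩

lemma mem_edgeIdeal_iff {f : MvPolynomial V K} :
    f ∈ edgeIdeal K G ↔ ∀ m ∈ f.support, ∃ i j, G.Adj i j ∧ m i ≠ 0 ∧ m j ≠ 0 := by
  classical
  have hgen : {f : MvPolynomial V K | ∃ i j : V, G.Adj i j ∧ f = X i * X j} =
      (fun s => monomial s (1 : K)) ''
        {m | ∃ i j, G.Adj i j ∧ m = Finsupp.single i 1 + Finsupp.single j 1} := by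
    ext f
    constructor
    · rintro ⟨i, j, hij, rfl⟩
      exact ⟨_, ⟨i, j, hij, rfl⟩, by simp [X, monomial_mul]⟩
    · rintro ⟨_, ⟨i, j, hij, rfl⟩, rfl⟩
      exact ⟨i, j, hij, by simp [X, monomial_mul]⟩
  rw [edgeIdeal, hgen, mem_ideal_span_monomial_image]
  refine forall₂_congr fun m _ => ⟨?_, ?_⟩
  · rintro ⟨_, ⟨i, j, hij, rfl⟩, hle⟩
    have hi := hle i
    have hj := hle j
    simp only [Finsupp.add_apply, Finsupp.single_apply] at hi hj
    refine ⟨i, j, hij, ?_, ?_⟩ <;> grind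
  · rintro ⟨i, j, hij, hi, hj⟩
    refine ⟨_, ⟨i, j, hij, rfl⟩, fun k => ?_⟩
    have hne := hij.ne
    simp only [Finsupp.add_apply, Finsupp.single_apply]
    grind

/-- The substitution killing the variables outside `A`. -/
noncomputable def restrictVars (K : Type*) [Field K] (A : Set V) :
    MvPolynomial V K →ₐ[K] MvPolynomial A K :=
  open Classical in aeval fun v => if h : v ∈ A then X ⟨v, h⟩ else 0

lemma restrictVars_X_of_mem {A : Set V} {v : V} (h : v ∈ A) :
    restrictVars K A (X v) = X ⟨v, h⟩ := by
  simp [restrictVars, h]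

lemma restrictVars_X_of_notMem {A : Set V} {v : V} (h : v ∉ A) :
    restrictVars K A (X v) = 0 := by
  simp [restrictVars, h]

lemma restrictVars_surjective (A : Set V) : Function.Surjective (restrictVars K A) := by
  intro f
  refine ⟨rename Subtype.val f, ?_⟩
  have h : (restrictVars K A).comp (rename Subtype.val) = AlgHom.id K _ := by
    ext v
    simp [restrictVars_X_of_mem v.2]
  exact DFunLike.congr_fun h f

lemma edgeIdeal_le_ker_restrictVars {A : Set V} (hA : IsStableSet' G A) :
    edgeIdeal K G ≤ RingHom.ker (restrictVars K A) := by
  refine edgeIdeal_le_iff.2 fun i j hij => ?_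
  rw [RingHom.mem_ker, map_mul]
  by_cases hi : i ∈ A
  · rw [restrictVars_X_of_notMem (v := j) fun hj => hA i hi j hj hij, mul_zero]
  · rw [restrictVars_X_of_notMem hi, zero_mul]

/-- Modulo an ideal containing the variables outside `A`, restricting to `A` changes nothing. -/
lemma sub_rename_restrictVars_mem {A : Set V} {J : Ideal (MvPolynomial V K)}
    (hJ : ∀ v ∉ A, X v ∈ J) (f : MvPolynomial V K) :
    f - rename Subtype.val (restrictVars K A f) ∈ J := by
  rw [← Ideal.Quotient.mk_eq_mk_iff_sub_mem]
  have h : Ideal.Quotient.mkₐ K J =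
      (Ideal.Quotient.mkₐ K J).comp ((rename Subtype.val).comp (restrictVars K A)) := by
    ext v
    by_cases hv : v ∈ A
    · simp [restrictVars_X_of_mem hv]
    · simpa [restrictVars_X_of_notMem hv] using Ideal.Quotient.eq_zero_iff_mem.2 (hJ v hv)
  exact DFunLike.congr_fun h f

lemma ker_restrictVars_le {A : Set V} {J : Ideal (MvPolynomial V K)}
    (hJ : ∀ v ∉ A, X v ∈ J) : RingHom.ker (restrictVars K A) ≤ J := by
  intro f hf
  have h := sub_rename_restrictVars_mem hJ f
  rwa [RingHom.mem_ker.1 hf, map_zero, sub_zero] at h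

lemma ringKrullDim_mvPolynomial_subtype [Finite V] (A : Set V) :
    ringKrullDim (MvPolynomial A K) = (A.ncard : WithBot ℕ∞) := by
  rw [MvPolynomial.ringKrullDim_of_isNoetherianRing, ringKrullDim_eq_zero_of_field, zero_add]
  rfl

lemma IsStableSet'.ncard_le_ringKrullDim [Finite V] {A : Set V} (hA : IsStableSet' G A) :
    (A.ncard : WithBot ℕ∞) ≤ ringKrullDim (MvPolynomial V K ⧸ edgeIdeal K G) := by
  rw [← ringKrullDim_mvPolynomial_subtype (K := K)]
  exact ringKrullDim_le_of_surjective
    (Ideal.Quotient.lift _ (restrictVars K A).toRingHom (edgeIdeal_le_ker_restrictVars hA))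
    (Ideal.Quotient.lift_surjective_of_surjective _ _ (restrictVars_surjective A))

lemma isStableSet'_of_edgeIdeal_le {p : Ideal (MvPolynomial V K)} [p.IsPrime]
    (hp : edgeIdeal K G ≤ p) : IsStableSet' G {v | X v ∉ p} := fun _ hi _ hj hij =>
  (Ideal.IsPrime.mem_or_mem inferInstance (hp (X_mul_X_mem_edgeIdeal hij))).elim hi hj

lemma ringKrullDim_quotient_le_of_X_mem [Finite V] {A : Set V} {p : Ideal (MvPolynomial V K)}
    (hp : ∀ v ∉ A, X v ∈ p) : ringKrullDim (MvPolynomial V K ⧸ p) ≤ (A.ncard : WithBot ℕ∞) := by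
  rw [← ringKrullDim_mvPolynomial_subtype (K := K)]
  refine ringKrullDim_le_of_surjective
    ((Ideal.Quotient.mk p).comp (rename (R := K) (Subtype.val : A → V)).toRingHom) fun x => ?_
  obtain ⟨f, rfl⟩ := Ideal.Quotient.mk_surjective x
  exact ⟨restrictVars K A f,
    (Ideal.Quotient.mk_eq_mk_iff_sub_mem _ _).2 (sub_rename_restrictVars_mem hp f) |>.symm⟩

lemma ringKrullDim_quotient_le_of_forall_prime {R : Type*} [CommRing R] {I : Ideal R}
    {n : WithBot ℕ∞} (h : ∀ p : Ideal R, p.IsPrime → I ≤ p → ringKrullDim (R ⧸ p) ≤ n) :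
    ringKrullDim (R ⧸ I) ≤ n := by
  rw [ringKrullDim_quotient]
  refine iSup_le fun c => ?_
  have hle := h c.head.1.asIdeal c.head.1.2 c.head.2
  rw [ringKrullDim_quotient] at hle
  refine le_trans ?_ hle
  let c' : LTSeries (PrimeSpectrum.zeroLocus (c.head.1.asIdeal : Set R)) :=
    { length := c.length
      toFun := fun i => ⟨(c i).1, c.head_le i⟩
      step := fun i => c.step i }
  exact le_iSup (fun q : LTSeries _ => (q.length : WithBot ℕ∞)) c'

lemma ringKrullDim_quotient_edgeIdeal [Finite V] {n : ℕ}
    (hn : ∃ A, IsStableSet' G A ∧ A.ncard = n) (hmax : ∀ A, IsStableSet' G A → A.ncard ≤ n) :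
    ringKrullDim (MvPolynomial V K ⧸ edgeIdeal K G) = (n : WithBot ℕ∞) := by
  refine le_antisymm (ringKrullDim_quotient_le_of_forall_prime fun p hp hle => ?_) ?_
  · refine (ringKrullDim_quotient_le_of_X_mem (A := {v | X v ∉ p}) fun v => not_not.1).trans ?_
    exact_mod_cast hmax _ (isStableSet'_of_edgeIdeal_le hle)
  · obtain ⟨A, hA, rfl⟩ := hn
    exact hA.ncard_le_ringKrullDim

lemma mem_colon_span_singleton_iff {R : Type*} [CommRing R] {I : Ideal R} {f g : R} :
    g ∈ Submodule.colon I (Ideal.span {f} : Set R) ↔ g * f ∈ I := by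
  rw [Submodule.mem_colon]
  refine ⟨fun h => h f (Ideal.mem_span_singleton_self f), fun h x hx => ?_⟩
  obtain ⟨c, rfl⟩ := Ideal.mem_span_singleton'.1 hx
  rw [smul_eq_mul, mul_left_comm]
  exact I.mul_mem_left c h

lemma mem_associatedPrimes_quotient {R : Type*} [CommRing R] {I p : Ideal R} {f : R}
    [hp : p.IsPrime] (h : Submodule.colon I (Ideal.span {f} : Set R) = p) :
    p ∈ associatedPrimes R (R ⧸ I) := by
  refine ⟨hp, Ideal.Quotient.mk I f, ?_⟩
  rw [eq_comm, ← hp.radical]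
  congr 1
  ext g
  rw [← h, mem_colon_span_singleton_iff, Submodule.mem_colon_singleton, Submodule.mem_bot,
    ← Ideal.Quotient.eq_zero_iff_mem, map_mul]
  rfl

/-- The degrees whose minimum is the v-number of `I`. -/
def vDegrees (I : Ideal (MvPolynomial V K)) : Set ℕ :=
  {d | ∃ f : MvPolynomial V K, f.IsHomogeneous d ∧
    ∃ p ∈ associatedPrimes (MvPolynomial V K) (MvPolynomial V K ⧸ I),
      Submodule.colon I (Ideal.span {f}) = p}

lemma IsCoveringStableSet.ncard_mem_vDegrees [Finite V] {A : Set V}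
    (hA : IsCoveringStableSet G A) : A.ncard ∈ vDegrees (edgeIdeal K G) := by
  classical
  have := Fintype.ofFinite V
  have hker := RingHom.ker_isPrime (restrictVars K (neighborsOf G A)ᶜ)
  have hcolon : Submodule.colon (edgeIdeal K G)
      (Ideal.span {∏ a ∈ A.toFinset, (X a : MvPolynomial V K)} : Set (MvPolynomial V K)) =
      RingHom.ker (restrictVars K (neighborsOf G A)ᶜ) := by
    refine le_antisymm (fun g hg => ?_) (ker_restrictVars_le fun v hv => ?_)
    · rw [mem_colon_span_singleton_iff] at hg
      refine (hker.mem_or_mem (edgeIdeal_le_ker_restrictVars hA.2 hg)).resolve_right ?_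
      rw [RingHom.mem_ker, map_prod, Finset.prod_eq_zero_iff]
      rintro ⟨a, ha, h0⟩
      rw [restrictVars_X_of_mem (hA.1.subset_compl_neighborsOf (Set.mem_toFinset.1 ha))] at h0
      exact X_ne_zero _ h0
    · obtain ⟨a, ha, hav⟩ := not_not.1 hv
      rw [mem_colon_span_singleton_iff, ← Finset.mul_prod_erase _ _ (Set.mem_toFinset.2 ha),
        ← mul_assoc]
      exact Ideal.mul_mem_right _ _ (X_mul_X_mem_edgeIdeal hav.symm)
  refine ⟨_, ?_, _, mem_associatedPrimes_quotient hcolon, hcolon⟩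
  rw [Set.ncard_eq_toFinset_card']
  simpa using IsHomogeneous.prod A.toFinset (fun a => (X a : MvPolynomial V K)) (fun _ => 1)
    fun a _ => isHomogeneous_X K a

lemma exists_isCoveringStableSet_of_mem_vDegrees {d : ℕ}
    (hd : d ∈ vDegrees (edgeIdeal K G)) : ∃ A, IsCoveringStableSet G A ∧ A.ncard ≤ d := by
  classical
  obtain ⟨f, hf, p, hpass, hp⟩ := hd
  have hprime : p.IsPrime := hpass.isPrime
  have hmem : ∀ g, g ∈ p ↔ g * f ∈ edgeIdeal K G := fun g => by
    rw [← hp, mem_colon_span_singleton_iff]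
  have hIp : edgeIdeal K G ≤ p := fun g hg => (hmem g).2 (Ideal.mul_mem_right _ _ hg)
  have hfI : f ∉ edgeIdeal K G := fun h =>
    hprime.ne_top ((Ideal.eq_top_iff_one p).2 ((hmem 1).2 (by rwa [one_mul])))
  rw [mem_edgeIdeal_iff] at hfI
  push Not at hfI
  obtain ⟨m, hm, hstable⟩ := hfI
  refine ⟨m.support, ⟨fun i hi j hj hij => ?_, ?_⟩, ?_⟩
  · exact Finsupp.mem_support_iff.1 hj (hstable i j hij (Finsupp.mem_support_iff.1 hi))
  · refine (isStableSet'_of_edgeIdeal_le hIp).mono fun v hv hvp => hv ?_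
    rw [hmem, mem_edgeIdeal_iff] at hvp
    obtain ⟨i, j, hij, hi, hj⟩ := hvp (Finsupp.single v 1 + m) (by
      rw [mem_support_iff, coeff_X_mul]
      exact mem_support_iff.1 hm)
    rw [Finsupp.add_apply, Finsupp.single_apply] at hi hj
    by_cases hmi : m i = 0
    · obtain rfl : v = i := by grind
      have hmj : m j ≠ 0 := by have := hij.ne; grind
      exact ⟨j, Finsupp.mem_support_iff.2 hmj, hij.symm⟩
    · have hmj := hstable i j hij hmi
      obtain rfl : v = j := by grind
      exact ⟨i, Finsupp.mem_support_iff.2 hmi, hij⟩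
  · rw [Set.ncard_coe_finset, ← hf (mem_support_iff.1 hm), Pi.one_def, ← Finsupp.degree_eq_weight_one,
      Finset.card_eq_sum_ones]
    exact Finset.sum_le_sum fun i hi =>
      Nat.one_le_iff_ne_zero.2 (Finsupp.mem_support_iff.1 hi)

lemma sInf_vDegrees_eq_iff [Finite V] {n : ℕ} (hn : ∃ A, IsStableSet' G A ∧ A.ncard = n)
    (hmax : ∀ A, IsStableSet' G A → A.ncard ≤ n) :
    n = sInf (vDegrees (edgeIdeal K G)) ↔ ∀ A, IsCoveringStableSet G A → n ≤ A.ncard := by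
  obtain ⟨M, hM, hMn⟩ := hn
  have hMcov : IsCoveringStableSet G M := IsMaximalStableSet.isCoveringStableSet
    ⟨hM, fun B hB hMB => Set.eq_of_subset_of_ncard_le hMB (hMn ▸ hmax B hB)⟩
  have hmem : n ∈ vDegrees (edgeIdeal K G) := hMn ▸ hMcov.ncard_mem_vDegrees
  refine ⟨fun h A hA => h ▸ Nat.sInf_le hA.ncard_mem_vDegrees, fun h => ?_⟩
  refine le_antisymm ?_ (Nat.sInf_le hmem)
  obtain ⟨A, hA, hle⟩ := exists_isCoveringStableSet_of_mem_vDegrees (Nat.sInf_mem ⟨n, hmem⟩)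
  exact (h A hA).trans hle

end EdgeIdeal

lemma exists_max_ncard_stableSet {V : Type*} [Finite V] (G : SimpleGraph V) :
    ∃ n, (∃ A, IsStableSet' G A ∧ A.ncard = n) ∧ ∀ A, IsStableSet' G A → A.ncard ≤ n := by
  obtain ⟨M, hM, hmax⟩ := Set.exists_max_image {A | IsStableSet' G A} Set.ncard
    (Set.toFinite _) ⟨∅, fun _ h => h.elim⟩
  exact ⟨M.ncard, ⟨M, hM, rfl⟩, hmax⟩

/-- Let `G` be a graph on `{t_1,…,t_s}` without isolated vertices and
`I = I(G)` its edge ideal.  Then `G` belongs to the class `W₂` (`G` is well-covered,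
`G ∖ v` is well-covered for every vertex `v`, and `G` has no isolated vertices) iff the
v-number `v(I)` equals the Krull dimension of `S/I`. -/
theorem graph_in_W2_iff_vNumber_eq_dim
    {s : ℕ} (K : Type*) [Field K] (G : SimpleGraph (Fin s))
    (hiso : ∀ v : Fin s, ∃ u : Fin s, G.Adj v u)
    (I : Ideal (MvPolynomial (Fin s) K))
    (hI : I = Ideal.span {f : MvPolynomial (Fin s) K | ∃ i j : Fin s, G.Adj i j ∧ f = X i * X j})
    (vnum : ℕ)
    (hv : vnum = sInf {d : ℕ | ∃ f : MvPolynomial (Fin s) K, f.IsHomogeneous d ∧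
      ∃ p ∈ associatedPrimes (MvPolynomial (Fin s) K) (MvPolynomial (Fin s) K ⧸ I),
        Submodule.colon I (Ideal.span {f}) = p}) :
    (WellCovered G ∧
        (∀ v : Fin s, WellCovered (G.induce {u : Fin s | u ≠ v})) ∧
        (∀ v : Fin s, ∃ u : Fin s, G.Adj v u)) ↔
      ringKrullDim (MvPolynomial (Fin s) K ⧸ I) = (vnum : WithBot ℕ∞) := by
  obtain ⟨n, hn, hmax⟩ := exists_max_ncard_stableSet G
  subst hI
  have hdim := ringKrullDim_quotient_edgeIdeal (K := K) hn hmax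
  have hvn := sInf_vDegrees_eq_iff (K := K) hn hmax
  rw [edgeIdeal] at hdim hvn
  rw [vDegrees, ← hv] at hvn
  rw [hdim, Nat.cast_inj, hvn]
  refine ⟨fun h A hA => le_ncard_of_covering hiso hn hmax h.1 h.2.1 hA, fun h => ?_⟩
  exact ⟨wellCovered_of_le_ncard_covering hmax h,
    wellCovered_induce_of_le_ncard_covering hmax h, hiso⟩
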